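/- Let (A_S,S) be an Artin-Tits system and X,Y,Z ⊆ S. If g is a positive Y-ribbon-X which is reduced-X, and h is a positive Z-ribbon-Y which is reduced-Y, then hg is a positive Z-ribbon-X which is reduced-X. -/

import Mathlib

/-!
Common definitions for formalizing "Normalisateur des sous-groupes paraboliques
des groupes d'Artin-Tits" (E. Godelle).

We fix a Coxeter matrix `M` over a finite index set `B` (Mathlib's convention:
`M s t = 0` encodes `m_{s,t} = ∞`).  The Artin-Tits group `Artin M` is the
presented group on the braid relations, the Coxeter group is Mathlib's
`M.Group`, and `proj : Artin M →* M.Group` is the canonical projection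
(adding the relations `s² = 1`).
-/

namespace ArtinTitsPaper

open List

variable {B : Type*}

/-- The alternating list `[s, t, s, t, ...]` with `n` terms, starting with `s`. -/
def altList (s t : B) : ℕ → List B
  | 0 => []
  | n + 1 => s :: altList t s n

/-- The braid relators `(sts⋯)(tst⋯)⁻¹` (`m_{s,t}` letters each) for `s ≠ t`,
`m_{s,t} ≠ ∞`. -/
def braidRels (M : CoxeterMatrix B) : Set (FreeGroup B) :=
  { r | ∃ s t : B, s ≠ t ∧ M s t ≠ 0 ∧
      r = ((altList s t (M s t)).map FreeGroup.of).prod *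
          (((altList t s (M s t)).map FreeGroup.of).prod)⁻¹ }

/-- The Artin-Tits group associated to the Coxeter matrix `M`. -/
def Artin (M : CoxeterMatrix B) : Type _ := PresentedGroup (braidRels M)

instance (M : CoxeterMatrix B) : Group (Artin M) :=
  QuotientGroup.Quotient.group _

/-- The standard generator of `Artin M` indexed by `s : B` (the image of `S` in `A_S`). -/
def gen (M : CoxeterMatrix B) (s : B) : Artin M := PresentedGroup.of s

theorem altList_eq_reverse_alternatingWord (s t : B) (n : ℕ) :
    altList s t n = (CoxeterSystem.alternatingWord t s n).reverse := by
  induction n generalizing s t with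
  | zero => rfl
  | succ n ih =>
      rw [altList, CoxeterSystem.alternatingWord_succ, List.concat_eq_append,
        List.reverse_append]
      simp [ih]

theorem lift_simple_listProd (M : CoxeterMatrix B) (l : List B) :
    FreeGroup.lift M.simple ((l.map FreeGroup.of).prod) =
      M.toCoxeterSystem.wordProd l := by
  rw [CoxeterSystem.wordProd, map_list_prod, List.map_map]
  simp [Function.comp_def, CoxeterMatrix.toCoxeterSystem_simple]

theorem braid_lift (M : CoxeterMatrix B) :
    ∀ r ∈ braidRels M, FreeGroup.lift M.simple r = 1 := by
  rintro r ⟨s, t, hst, hm, rfl⟩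
  rw [map_mul, map_inv, lift_simple_listProd, lift_simple_listProd,
    altList_eq_reverse_alternatingWord, altList_eq_reverse_alternatingWord,
    CoxeterSystem.wordProd_reverse, CoxeterSystem.wordProd_reverse]
  have hsym : M s t = M t s := M.symmetric s t
  have hb := M.toCoxeterSystem.wordProd_braidWord_eq t s
  rw [CoxeterSystem.braidWord, CoxeterSystem.braidWord, ← hsym] at hb
  rw [hb]
  simp

/-- The canonical projection from the Artin-Tits group onto the Coxeter group
(adding the relations `s² = 1`). -/
def proj (M : CoxeterMatrix B) : Artin M →* M.Group :=
  PresentedGroup.toGroup (braid_lift M)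

/-- The positive monoid `A_S⁺`, the submonoid of `A_S` generated by `S`. -/
def posMon (M : CoxeterMatrix B) : Submonoid (Artin M) :=
  Submonoid.closure (Set.range (gen M))

/-- The submonoid `A_X⁺` of `A_S` generated by `X ⊆ S`. -/
def posMonOn (M : CoxeterMatrix B) (X : Set B) : Submonoid (Artin M) :=
  Submonoid.closure (gen M '' X)

/-- The standard parabolic subgroup `A_X` of `A_S` generated by `X ⊆ S`. -/
def stdSub (M : CoxeterMatrix B) (X : Set B) : Subgroup (Artin M) :=
  Subgroup.closure (gen M '' X)

/-- The standard parabolic subgroup `W_X` of the Coxeter group `W_S`. -/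
def coxSub (M : CoxeterMatrix B) (X : Set B) : Subgroup M.Group :=
  Subgroup.closure (M.simple '' X)

/-- `X ⊆ S` is of spherical type if the Coxeter group `W_X` is finite. -/
def IsSpherical (M : CoxeterMatrix B) (X : Set B) : Prop :=
  Finite (coxSub M X)

/-- `a` left-divides `b` in the positive monoid: `b = a c` with `c ∈ A_S⁺`. -/
def ldvd (M : CoxeterMatrix B) (a b : Artin M) : Prop :=
  ∃ c ∈ posMon M, a * c = b

/-- `a` right-divides `b` in the positive monoid: `b = c a` with `c ∈ A_S⁺`. -/
def rdvd (M : CoxeterMatrix B) (a b : Artin M) : Prop :=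
  ∃ c ∈ posMon M, c * a = b

/-- `d` is the least common multiple `Δ_X` of `X` in `A_X⁺` (for left-divisibility). -/
def IsDelta (M : CoxeterMatrix B) (X : Set B) (d : Artin M) : Prop :=
  d ∈ posMonOn M X ∧
  (∀ s ∈ X, ∃ c ∈ posMonOn M X, gen M s * c = d) ∧
  ∀ m ∈ posMonOn M X, (∀ s ∈ X, ∃ c ∈ posMonOn M X, gen M s * c = m) →
    ∃ c ∈ posMonOn M X, d * c = m

/-- The subset `Xg = {σ_x g : x ∈ X}` of `A_S`. -/
def leftMul (M : CoxeterMatrix B) (X : Set B) (g : Artin M) : Set (Artin M) :=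
  (fun x => gen M x * g) '' X

/-- The subset `gX = {g σ_x : x ∈ X}` of `A_S`. -/
def rightMul (M : CoxeterMatrix B) (X : Set B) (g : Artin M) : Set (Artin M) :=
  (fun x => g * gen M x) '' X

/-- `Conj(S;X,Y) = {g ∈ A_S : gX = Yg}`. -/
def conjSet (M : CoxeterMatrix B) (X Y : Set B) : Set (Artin M) :=
  { g | rightMul M X g = leftMul M Y g }

/-- `Conj⁺(S;X,Y) = {g ∈ A_S⁺ : gX = Yg}`. -/
def conjPos (M : CoxeterMatrix B) (X Y : Set B) : Set (Artin M) :=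
  { g | g ∈ posMon M ∧ rightMul M X g = leftMul M Y g }

/-- The quasi-centralizer `QZ_{A_S}(A_X) = {g ∈ A_S : gX = Xg}`. -/
def QZset (M : CoxeterMatrix B) (X : Set B) : Set (Artin M) :=
  conjSet M X X

/-- The indecomposable component of `Z` containing `t` (vertices of `Z` joined to `t`
by a path of edges `m_{a,b} ≠ 2` in the Coxeter diagram on `Z`). -/
def comp (M : CoxeterMatrix B) (Z : Set B) (t : B) : Set B :=
  { s ∈ Z | Relation.ReflTransGen (fun a b => a ∈ Z ∧ b ∈ Z ∧ a ≠ b ∧ M a b ≠ 2) t s }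

/-- `Z` is indecomposable: it admits no nontrivial partition `Z = Z₁ ∪ Z₂` with
`m_{a,b} = 2` for `a ∈ Z₁`, `b ∈ Z₂`. -/
def Indecomp (M : CoxeterMatrix B) (Z : Set B) : Prop :=
  ¬ ∃ Z₁ Z₂ : Set B, Z₁.Nonempty ∧ Z₂.Nonempty ∧ Z₁ ∪ Z₂ = Z ∧ Disjoint Z₁ Z₂ ∧
      ∀ a ∈ Z₁, ∀ b ∈ Z₂, M a b = 2

/-- `g` is an elementary positive `Y`-ribbon-`X`: `g = d_{X,t}` for some `t ∈ S` with
`X(t)` of spherical type, where `d_{X,t} = Δ_{X(t)}` if `t ∈ X` and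
`d_{X,t} = Δ_{X(t)} Δ_{X(t)∖{t}}⁻¹` otherwise, and `Y ⊆ X ∪ {t}` satisfies `Yg = gX`. -/
def IsElemRibbon (M : CoxeterMatrix B) (X Y : Set B) (g : Artin M) : Prop :=
  ∃ t : B, IsSpherical M (comp M (X ∪ {t}) t) ∧
    ((t ∈ X ∧ IsDelta M (comp M (X ∪ {t}) t) g) ∨
      (t ∉ X ∧ ∃ d₁ d₂ : Artin M, IsDelta M (comp M (X ∪ {t}) t) d₁ ∧
        IsDelta M ((comp M (X ∪ {t}) t) \ {t}) d₂ ∧ g = d₁ * d₂⁻¹)) ∧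
    Y ⊆ X ∪ {t} ∧ leftMul M Y g = rightMul M X g

/-- `g` is a positive `Y`-ribbon-`X`: a product `g = g_n ⋯ g_1` of elementary positive
`X_i`-ribbons-`X_{i-1}` with `X_0 = X`, `X_n = Y`. -/
inductive IsRibbon (M : CoxeterMatrix B) : Set B → Set B → Artin M → Prop
  | nil (X : Set B) : IsRibbon M X X 1
  | cons {X Y Z : Set B} {g h : Artin M} :
      IsRibbon M X Y g → IsElemRibbon M Y Z h → IsRibbon M X Z (h * g)

/-- `g` is `X`-reduced: no element of `X` left-divides `g`. -/
def lreduced (M : CoxeterMatrix B) (X : Set B) (g : Artin M) : Prop :=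
  ∀ s ∈ X, ¬ ldvd M (gen M s) g

/-- `g` is reduced-`X`: no element of `X` right-divides `g`. -/
def rreduced (M : CoxeterMatrix B) (X : Set B) (g : Artin M) : Prop :=
  ∀ s ∈ X, ¬ rdvd M (gen M s) g

/-- The set `H_X` of elements `g₁ g₂⁻¹` where `g₁, g₂` are `X`-reduced positive
`X`-ribbons-`X`. -/
def HXset (M : CoxeterMatrix B) (X : Set B) : Set (Artin M) :=
  { g | ∃ g₁ g₂ : Artin M, IsRibbon M X X g₁ ∧ lreduced M X g₁ ∧
      IsRibbon M X X g₂ ∧ lreduced M X g₂ ∧ g = g₁ * g₂⁻¹ }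

/-- The length of a positive element (the common length of its expressions as words
in the generators; junk value `0` outside of `A_S⁺`). -/
noncomputable def len (M : CoxeterMatrix B) (g : Artin M) : ℕ :=
  sInf { n | ∃ l : List B, l.length = n ∧ (l.map (gen M)).prod = g }

/-- The length of an element of the Coxeter group `W_S`. -/
noncomputable def wlen (M : CoxeterMatrix B) (w : M.Group) : ℕ :=
  sInf { n | ∃ l : List B, l.length = n ∧ (l.map M.simple).prod = w }

/-- `g ∈ A_{S,red}`: `g` is positive and has the same length as its image in `W_S`. -/
def Red (M : CoxeterMatrix B) (g : Artin M) : Prop :=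
  g ∈ posMon M ∧ len M g = wlen M (proj M g)

/-- `C` is a simple `s`-chain-`u`: either `C = 1` and `s = u`, or
`C = tst⋯` (`k` letters, `k < m_{s,t}`) with `u ∈ {s,t}` and `C·u = tst⋯` (`k+1` letters). -/
def IsSimpleChain (M : CoxeterMatrix B) (s u : B) (C : Artin M) : Prop :=
  (C = 1 ∧ s = u) ∨
  ∃ t : B, t ≠ s ∧ (u = s ∨ u = t) ∧ ∃ k : ℕ,
    (M s t = 0 ∨ k < M s t) ∧
    C = ((altList t s k).map (gen M)).prod ∧
    C * gen M u = ((altList t s (k + 1)).map (gen M)).prod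

/-- `C` is an `s`-chain-`t`: a product `C₁ ⋯ C_k` of simple chains composing from
origin `s` to target `t`. -/
inductive IsChain (M : CoxeterMatrix B) : B → B → Artin M → Prop
  | single {s u : B} {C : Artin M} : IsSimpleChain M s u C → IsChain M s u C
  | comp {s u v : B} {C D : Artin M} :
      IsChain M s u C → IsSimpleChain M u v D → IsChain M s v (C * D)


/-! ### The geometric representation -/

section Geometric

open Polynomial.Chebyshev Module

/-- The linear form `v ↦ 2⟨α_s, v⟩` on the geometric representation. -/
noncomputable def geomCoroot (M : CoxeterMatrix B) (s : B) : Module.Dual ℝ (B →₀ ℝ) :=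
  Finsupp.linearCombination ℝ (fun b => -2 * Real.cos (Real.pi / M s b))

theorem geomCoroot_single (M : CoxeterMatrix B) (s t : B) :
    geomCoroot M s (Finsupp.single t 1) = -2 * Real.cos (Real.pi / M s t) := by
  simp [geomCoroot]

theorem geomCoroot_single_self (M : CoxeterMatrix B) (s : B) :
    geomCoroot M s (Finsupp.single s 1) = 2 := by
  simp [geomCoroot_single]

/-- The reflection attached to a generator in the geometric representation. -/
noncomputable def geomReflection (M : CoxeterMatrix B) (s : B) : (B →₀ ℝ) ≃ₗ[ℝ] (B →₀ ℝ) :=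
  Module.reflection (geomCoroot_single_self M s)

theorem geomCoroot_mul_geomCoroot (M : CoxeterMatrix B) (s t : B) :
    geomCoroot M s (Finsupp.single t 1) * geomCoroot M t (Finsupp.single s 1) - 2 =
      2 * Real.cos (2 * (Real.pi / M s t)) := by
  rw [geomCoroot_single, geomCoroot_single, M.symmetric t s, Real.cos_two_mul]
  ring

theorem sin_two_mul_pi_div_ne_zero {m : ℕ} (hm : 3 ≤ m) :
    Real.sin (2 * (Real.pi / m)) ≠ 0 := by
  have h3 : (3 : ℝ) ≤ m := by exact_mod_cast hm
  have hpi := Real.pi_pos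
  apply ne_of_gt
  apply Real.sin_pos_of_pos_of_lt_pi
  · positivity
  · rw [← mul_div_assoc, div_lt_iff₀ (by linarith)]
    nlinarith

theorem geomReflection_mul_pow (M : CoxeterMatrix B) (s t : B) :
    (geomReflection M s * geomReflection M t) ^ M s t = 1 := by
  rcases eq_or_ne s t with rfl | hst
  · rw [M.diagonal, pow_one, geomReflection]
    nth_rw 1 [← Module.reflection_inv, inv_mul_cancel]
  have hm1 : M s t ≠ 1 := M.off_diagonal s t hst
  obtain h0 | h2 | h3 : M s t = 0 ∨ M s t = 2 ∨ 3 ≤ M s t := by lia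
  · rw [h0, pow_zero]
  · have hc := geomCoroot_single M s t
    have hc' := geomCoroot_single M t s
    rw [M.symmetric t s] at hc'
    rw [h2] at hc hc' ⊢
    simp only [Nat.cast_ofNat, Real.cos_pi_div_two, mul_zero] at hc hc'
    have hs := geomCoroot_single_self M s
    have ht := geomCoroot_single_self M t
    ext1 v
    simp only [geomReflection, pow_two, LinearEquiv.mul_apply, Module.reflection_apply, map_sub,
      map_smul, hc, hc', hs, ht, LinearEquiv.coe_one, id_eq]
    module
  · have hsin := sin_two_mul_pi_div_ne_zero h3
    have hmpos : (M s t : ℝ) ≠ 0 := by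
      have : M s t ≠ 0 := by lia
      exact_mod_cast this
    have hS (n : ℤ) := S_two_mul_real_cos (2 * (Real.pi / M s t)) n
    ext1 v
    rw [geomReflection, geomReflection, Module.reflection_mul_reflection_pow_apply _ _ _ _ _
      (geomCoroot_mul_geomCoroot M s t).symm]
    obtain ⟨k, hk | hk⟩ := Nat.even_or_odd' (M s t)
    · have hz : (S ℝ (k - 1)).eval (2 * Real.cos (2 * (Real.pi / M s t))) = 0 := by
        have h := hS (k - 1)
        have : (((k - 1 : ℤ) : ℝ) + 1) * (2 * (Real.pi / M s t)) = Real.pi := by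
          have : (M s t : ℝ) = 2 * k := by exact_mod_cast hk
          push_cast
          field_simp
          rw [this]; ring
        rw [this, Real.sin_pi] at h
        exact (mul_eq_zero.mp h).resolve_right hsin
      have e1 : ((M s t : ℤ) - 2) / 2 = k - 1 := by lia
      have e2 : ((M s t : ℤ) - 1) / 2 = k - 1 := by lia
      simp [e1, e2, hz]
    · have hz : (S ℝ k).eval (2 * Real.cos (2 * (Real.pi / M s t))) +
          (S ℝ (k - 1)).eval (2 * Real.cos (2 * (Real.pi / M s t))) = 0 := by
        have h := hS k
        have h' := hS (k - 1)
        have : (((k - 1 : ℤ) : ℝ) + 1) * (2 * (Real.pi / M s t)) =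
            2 * Real.pi - (((k : ℤ) : ℝ) + 1) * (2 * (Real.pi / M s t)) := by
          have : (M s t : ℝ) = 2 * k + 1 := by exact_mod_cast hk
          push_cast
          field_simp
          rw [this]; ring
        rw [this, Real.sin_two_pi_sub] at h'
        refine (mul_eq_zero.mp ?_).resolve_right hsin
        rw [add_mul, h, h', add_neg_cancel]
      have e1 : ((M s t : ℤ) - 2) / 2 = k - 1 := by lia
      have e2 : ((M s t : ℤ) - 1) / 2 = k := by lia
      have e3 : ((M s t : ℤ) - 3) / 2 = k - 1 := by lia
      have e4 : (M s t : ℤ) / 2 = k := by lia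
      simp [e1, e2, e3, e4, hz]

theorem geomReflection_mul_pow_ne_one (M : CoxeterMatrix B) {s t : B} (hst : s ≠ t) {n : ℕ}
    (hn : 0 < n) (hnm : M s t = 0 ∨ n < M s t) :
    (geomReflection M s * geomReflection M t) ^ n ≠ 1 := by
  intro h
  have h1 := congrArg (fun φ : (B →₀ ℝ) ≃ₗ[ℝ] (B →₀ ℝ) => φ (Finsupp.single s 1)) h
  simp only [geomReflection, LinearEquiv.coe_one, id_eq] at h1
  rw [Module.reflection_mul_reflection_pow_apply_self _ _ _ _
      (geomCoroot_mul_geomCoroot M s t).symm] at h1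
  have hs := congrArg (fun v : B →₀ ℝ => v s) h1
  have ht := congrArg (fun v : B →₀ ℝ => v t) h1
  simp [hst, hst.symm, geomCoroot_single, M.symmetric t s] at hs ht
  have hm1 : M s t ≠ 1 := M.off_diagonal s t hst
  obtain h0 | h2 | h3 : M s t = 0 ∨ M s t = 2 ∨ 3 ≤ M s t := by lia
  · simp [h0, S_eval_two] at hs
    have : n + 1 + n = 1 := by exact_mod_cast hs
    lia
  · have : n = 1 := by lia
    subst this
    simp [h2, mul_div_cancel₀] at hs
  · have hsin := sin_two_mul_pi_div_ne_zero h3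
    have hpi := Real.pi_pos
    have h3' : (3 : ℝ) ≤ M s t := by exact_mod_cast h3
    have hcos : Real.cos (Real.pi / M s t) ≠ 0 := by
      intro h0
      apply hsin
      rw [Real.sin_two_mul, h0, mul_zero]
    have hz := ht.resolve_right hcos
    rw [hz, add_zero] at hs
    have hSn := S_two_mul_real_cos (2 * (Real.pi / M s t)) n
    have hSn' := S_two_mul_real_cos (2 * (Real.pi / M s t)) (n - 1)
    rw [hz, zero_mul] at hSn'
    rw [hs, one_mul] at hSn
    push_cast at hSn hSn'
    rw [sub_add_cancel] at hSn'
    have hlt : n < M s t := by lia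
    have hlt' : (n : ℝ) < M s t := by exact_mod_cast hlt
    have hn' : (0 : ℝ) < n := by exact_mod_cast hn
    have hc : Real.cos (n * (2 * (Real.pi / M s t))) = 1 := by
      rw [add_mul, one_mul, Real.sin_add, ← hSn', zero_mul, zero_add] at hSn
      exact (mul_right_cancel₀ hsin (by rw [one_mul]; exact hSn)).symm
    obtain ⟨k, hk⟩ := (Real.cos_eq_one_iff _).mp hc
    have hk' : (k : ℝ) * M s t = n := by
      field_simp at hk
      linarith
    have hk1 : k * (M s t : ℤ) = n := by exact_mod_cast hk'
    have hk0 : 0 < k := by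
      by_contra hneg
      nlinarith [Int.natCast_nonneg (M s t), Int.natCast_pos.mpr hn]
    nlinarith [Int.natCast_nonneg (M s t), Int.ofNat_lt.mpr hlt]

theorem simple_mul_simple_pow_ne_one {W : Type*} [Group W] {M : CoxeterMatrix B}
    (cs : CoxeterSystem M W) {s t : B} (hst : s ≠ t) {n : ℕ}
    (hn : 0 < n) (hnm : M s t = 0 ∨ n < M s t) :
    (cs.simple s * cs.simple t) ^ n ≠ 1 := by
  intro h
  have hl : M.IsLiftable (geomReflection M) := geomReflection_mul_pow M
  have := congrArg (cs.lift ⟨_, hl⟩) h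
  rw [map_pow, map_mul, cs.lift_apply_simple, cs.lift_apply_simple, map_one] at this
  exact geomReflection_mul_pow_ne_one M hst hn hnm this

end Geometric

/-! ### Inversion sequences and the exchange condition -/

section Exchange

variable {W : Type*} [Group W] {M : CoxeterMatrix B} (cs : CoxeterSystem M W)

theorem length_altList (s t : B) (n : ℕ) : (altList s t n).length = n := by
  induction n generalizing s t with
  | zero => rfl
  | succ n ih => simp [altList, ih]

theorem mem_altList {s t i : B} {n : ℕ} (h : i ∈ altList s t n) : i = s ∨ i = t := by
  induction n generalizing s t with
  | zero => simp [altList] at h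
  | succ n ih =>
    rcases List.mem_cons.mp h with h | h
    · exact Or.inl h
    · exact (ih h).symm

theorem prod_map_altList_two_mul {G : Type*} [Monoid G] (f : B → G) (s t : B) (n : ℕ) :
    ((altList s t (2 * n)).map f).prod = (f s * f t) ^ n := by
  induction n with
  | zero => simp [altList]
  | succ n ih =>
    rw [show 2 * (n + 1) = 2 * n + 1 + 1 by ring, altList, altList, pow_succ', ← ih]
    simp [mul_assoc]

theorem wordProd_altList_comm (s t : B) :
    cs.wordProd (altList s t (M s t)) = cs.wordProd (altList t s (M s t)) := by
  have h := cs.wordProd_braidWord_eq t s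
  rw [CoxeterSystem.braidWord, CoxeterSystem.braidWord, M.symmetric t s] at h
  rw [altList_eq_reverse_alternatingWord, altList_eq_reverse_alternatingWord,
    cs.wordProd_reverse, cs.wordProd_reverse, h]

theorem rightInvSeq_eq_map_leftInvSeq (ω : List B) :
    cs.rightInvSeq ω = (cs.leftInvSeq ω).map (MulAut.conj (cs.wordProd ω)⁻¹) := by
  induction ω with
  | nil => rfl
  | cons i ω ih =>
    rw [CoxeterSystem.rightInvSeq, CoxeterSystem.leftInvSeq, ih, cs.wordProd_cons]
    simp [mul_assoc]

theorem leftInvSeq_altList (s t : B) (n : ℕ) :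
    cs.leftInvSeq (altList s t n) =
      (List.range n).map (fun k => (cs.simple s * cs.simple t) ^ k * cs.simple s) := by
  induction n generalizing s t with
  | zero => rfl
  | succ n ih =>
    rw [altList, CoxeterSystem.leftInvSeq, ih, List.range_succ_eq_map]
    simp only [List.map_cons, List.map_map, pow_zero, one_mul, List.cons.injEq, true_and]
    refine List.map_congr_left fun k _ => ?_
    have h : ∀ k : ℕ, cs.simple s * (cs.simple t * cs.simple s) ^ k * cs.simple t =
        (cs.simple s * cs.simple t) ^ (k + 1) := by
      intro k
      induction k with
      | zero => simp
      | succ k ihk =>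
        rw [pow_succ' (cs.simple s * cs.simple t), ← ihk, pow_succ']
        simp only [mul_assoc]
    simp [← h, mul_assoc]

theorem leftInvSeq_altList_perm (s t : B) :
    (cs.leftInvSeq (altList s t (M s t))).Perm (cs.leftInvSeq (altList t s (M s t))) := by
  suffices h : cs.leftInvSeq (altList s t (M s t)) =
      (cs.leftInvSeq (altList t s (M s t))).reverse by
    rw [h]
    exact List.reverse_perm _
  have hkey : ∀ k j : ℕ, k + 1 + j = M s t →
      (cs.simple s * cs.simple t) ^ k * cs.simple s =
        (cs.simple t * cs.simple s) ^ j * cs.simple t := by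
    intro k j h
    have h1 := cs.simple_mul_simple_pow s t
    rw [← h, pow_add, pow_succ, mul_eq_one_iff_eq_inv, ← inv_pow, mul_inv_rev, cs.inv_simple,
      cs.inv_simple] at h1
    rw [← h1]
    simp [mul_assoc]
  rw [leftInvSeq_altList, leftInvSeq_altList]
  refine List.ext_getElem (by simp) fun k h₁ h₂ => ?_
  simp only [List.length_map, List.length_range] at h₁
  simp only [List.getElem_map, List.getElem_range, List.getElem_reverse, List.length_map,
    List.length_range]
  exact hkey _ _ (by lia)

theorem nodup_rightInvSeq_altList {s t : B} (hst : s ≠ t) {n : ℕ}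
    (hn : M s t = 0 ∨ n ≤ M s t) : (cs.rightInvSeq (altList s t n)).Nodup := by
  rw [rightInvSeq_eq_map_leftInvSeq, leftInvSeq_altList]
  refine List.Nodup.map (MulEquiv.injective _) (List.Nodup.map_on ?_ List.nodup_range)
  have key : ∀ i j, i < j → j < n → (cs.simple s * cs.simple t) ^ i * cs.simple s ≠
      (cs.simple s * cs.simple t) ^ j * cs.simple s := by
    intro i j hij hj h
    refine simple_mul_simple_pow_ne_one cs hst (n := j - i) (by lia) (by lia) ?_
    rw [pow_sub _ hij.le, ← mul_right_cancel h, mul_inv_cancel]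
  intro i hi j hj h
  rw [List.mem_range] at hi hj
  rcases lt_trichotomy i j with hij | hij | hij
  · exact (key i j hij hj h).elim
  · exact hij
  · exact (key j i hij hi h.symm).elim

open Classical in
/-- The action of a simple reflection on `W × R` which conjugates the first component and adds
`1` to the second one when the first one is that reflection. Its iterates count inversions. -/
noncomputable def inversionPerm (R : Type*) [Ring R] (i : B) : Equiv.Perm (W × R) where
  toFun p := (cs.simple i * p.1 * cs.simple i, p.2 + if p.1 = cs.simple i then 1 else 0)
  invFun p := (cs.simple i * p.1 * cs.simple i, p.2 - if p.1 = cs.simple i then 1 else 0)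
  left_inv p := by
    ext1
    · simp [mul_assoc]
    · have : cs.simple i * p.1 * cs.simple i = cs.simple i ↔ p.1 = cs.simple i := by
        rw [mul_assoc, mul_eq_left, mul_eq_one_iff_eq_inv, cs.inv_simple]
      simp [this]
  right_inv p := by
    ext1
    · simp [mul_assoc]
    · have : cs.simple i * p.1 * cs.simple i = cs.simple i ↔ p.1 = cs.simple i := by
        rw [mul_assoc, mul_eq_left, mul_eq_one_iff_eq_inv, cs.inv_simple]
      simp [this]

open Classical in
theorem prod_map_inversionPerm_apply (R : Type*) [Ring R] (ω : List B) (t : W) (r : R) :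
    (ω.map (inversionPerm cs R)).prod (t, r) =
      (cs.wordProd ω * t * (cs.wordProd ω)⁻¹, r + ((cs.rightInvSeq ω).count t : ℕ)) := by
  induction ω with
  | nil => simp
  | cons i ω ih =>
    rw [List.map_cons, List.prod_cons, Equiv.Perm.mul_apply, ih, CoxeterSystem.rightInvSeq,
      List.count_cons, cs.wordProd_cons]
    have : cs.wordProd ω * t * (cs.wordProd ω)⁻¹ = cs.simple i ↔
        (cs.wordProd ω)⁻¹ * cs.simple i * cs.wordProd ω = t := by
      rw [mul_inv_eq_iff_eq_mul, mul_assoc, inv_mul_eq_iff_eq_mul, eq_comm]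
    ext1
    · simp [inversionPerm, mul_assoc]
    · simp [inversionPerm, this, add_assoc]

theorem prod_map_inversionPerm_altList (R : Type*) [Ring R] (s t : B) :
    ((altList s t (M s t)).map (inversionPerm cs R)).prod =
      ((altList t s (M s t)).map (inversionPerm cs R)).prod := by
  classical
  ext1 ⟨w, r⟩
  rw [prod_map_inversionPerm_apply, prod_map_inversionPerm_apply,
    rightInvSeq_eq_map_leftInvSeq, rightInvSeq_eq_map_leftInvSeq, wordProd_altList_comm,
    ((leftInvSeq_altList_perm cs s t).map _).count_eq]

theorem isLiftable_inversionPerm : M.IsLiftable (inversionPerm cs (ZMod 2)) := by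
  classical
  intro s t
  rw [← prod_map_altList_two_mul]
  ext1 ⟨w, r⟩
  have h1 : cs.wordProd (altList s t (2 * M s t)) = 1 := by
    rw [CoxeterSystem.wordProd, prod_map_altList_two_mul, cs.simple_mul_simple_pow]
  rw [prod_map_inversionPerm_apply, rightInvSeq_eq_map_leftInvSeq, h1, leftInvSeq_altList,
    two_mul, List.range_add]
  have h2 : (fun k => (cs.simple s * cs.simple t) ^ k * cs.simple s) ∘ (fun x => M s t + x) =
      fun k => (cs.simple s * cs.simple t) ^ k * cs.simple s := by
    funext k
    simp [pow_add]
  simp [h2, CharTwo.add_self_eq_zero]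

theorem count_rightInvSeq_cast_eq [DecidableEq W] {ω ω' : List B}
    (h : cs.wordProd ω = cs.wordProd ω') (t : W) :
    ((cs.rightInvSeq ω).count t : ZMod 2) = ((cs.rightInvSeq ω').count t : ZMod 2) := by
  have key : ∀ ω : List B, ((cs.lift ⟨_, isLiftable_inversionPerm cs⟩ (cs.wordProd ω)) (t, 0)).2 =
      ((cs.rightInvSeq ω).count t : ZMod 2) := by
    intro ω
    have h1 : cs.lift ⟨_, isLiftable_inversionPerm cs⟩ (cs.wordProd ω) =
        (ω.map (inversionPerm cs (ZMod 2))).prod := by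
      rw [CoxeterSystem.wordProd, map_list_prod, List.map_map]
      congr 2
      funext i
      exact cs.lift_apply_simple _ i
    rw [h1, prod_map_inversionPerm_apply, zero_add]
    congr!
  rw [← key, ← key, h]

theorem mem_rightInvSeq_of_nodup {ω ω' : List B} (h : cs.wordProd ω = cs.wordProd ω')
    (hω : (cs.rightInvSeq ω).Nodup) {t : W} (ht : t ∈ cs.rightInvSeq ω) :
    t ∈ cs.rightInvSeq ω' := by
  classical
  have h1 := count_rightInvSeq_cast_eq cs h t
  rw [List.count_eq_one_of_mem hω ht] at h1
  by_contra hn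
  rw [List.count_eq_zero_of_not_mem hn] at h1
  simp at h1

theorem isReduced_of_nodup_rightInvSeq {ω : List B} (hω : (cs.rightInvSeq ω).Nodup) :
    cs.IsReduced ω := by
  obtain ⟨ω', hω', h⟩ := cs.exists_isReduced (cs.wordProd ω)
  have hsub : cs.rightInvSeq ω ⊆ cs.rightInvSeq ω' :=
    fun t ht => mem_rightInvSeq_of_nodup cs h hω ht
  have hle := (hω.subperm hsub).length_le
  rw [cs.length_rightInvSeq, cs.length_rightInvSeq] at hle
  refine le_antisymm (cs.length_wordProd_le ω) ?_
  rw [h, hω']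
  exact hle

theorem isReduced_altList {s t : B} (hst : s ≠ t) {n : ℕ} (hn : M s t = 0 ∨ n ≤ M s t) :
    cs.IsReduced (altList s t n) :=
  isReduced_of_nodup_rightInvSeq cs (nodup_rightInvSeq_altList cs hst hn)

theorem exists_isReduced_append_singleton {w : W} {i : B} (h : cs.IsRightDescent w i) :
    ∃ ω : List B, cs.IsReduced (ω ++ [i]) ∧ w = cs.wordProd (ω ++ [i]) := by
  obtain ⟨ω, hω, hw⟩ := cs.exists_isReduced (w * cs.simple i)
  have hw' : w = cs.wordProd (ω ++ [i]) := by
    rw [cs.wordProd_append, ← hw, cs.wordProd_singleton, cs.simple_mul_simple_cancel_right]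
  refine ⟨ω, ?_, hw'⟩
  rw [CoxeterSystem.IsReduced, ← hw', List.length_append, List.length_singleton, ← hω.eq, ← hw]
  exact (cs.isRightDescent_iff.mp h).symm

/-- The exchange condition. -/
theorem exists_mul_simple_eq_eraseIdx {ω : List B} {i : B}
    (h : cs.IsRightDescent (cs.wordProd ω) i) :
    ∃ j < ω.length, cs.wordProd ω * cs.simple i = cs.wordProd (ω.eraseIdx j) := by
  obtain ⟨ω', hω', hw⟩ := exists_isReduced_append_singleton cs h
  have hmem : cs.simple i ∈ cs.rightInvSeq ω := by
    refine mem_rightInvSeq_of_nodup cs hw.symm hω'.nodup_rightInvSeq ?_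
    rw [← List.concat_eq_append, cs.rightInvSeq_concat]
    simp
  obtain ⟨j, hj, hji⟩ := List.mem_iff_getElem.mp hmem
  refine ⟨j, by simpa using hj, ?_⟩
  rw [← cs.wordProd_mul_getD_rightInvSeq, List.getD_eq_getElem _ _ hj, hji]

theorem exists_isReduced_of_mem (U : Set B) (ω : List B) (hω : ∀ i ∈ ω, i ∈ U) :
    ∃ ω' : List B, (∀ i ∈ ω', i ∈ U) ∧ cs.IsReduced ω' ∧ cs.wordProd ω' = cs.wordProd ω := by
  induction ω using List.reverseRecOn with
  | nil => exact ⟨[], by simp, by simp [CoxeterSystem.IsReduced], rfl⟩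
  | append_singleton ω i ih =>
    obtain ⟨ω', hU, hred, heq⟩ := ih fun j hj => hω j (by simp [hj])
    rw [cs.wordProd_append, cs.wordProd_singleton, ← heq]
    by_cases hd : cs.IsRightDescent (cs.wordProd ω') i
    · obtain ⟨j, hj, hji⟩ := exists_mul_simple_eq_eraseIdx cs hd
      refine ⟨ω'.eraseIdx j, fun k hk => hU k (List.mem_of_mem_eraseIdx hk), ?_, hji.symm⟩
      have h1 := cs.isRightDescent_iff.mp hd
      rw [hji, hred.eq] at h1
      rw [CoxeterSystem.IsReduced, List.length_eraseIdx_of_lt hj]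
      lia
    · refine ⟨ω' ++ [i], ?_, ?_, by rw [cs.wordProd_append, cs.wordProd_singleton]⟩
      · intro k hk
        rcases List.mem_append.mp hk with hk | hk
        · exact hU k hk
        · exact hω k (by simp at hk; simp [hk])
      · rw [CoxeterSystem.IsReduced, cs.wordProd_append, cs.wordProd_singleton,
          cs.not_isRightDescent_iff.mp hd, hred.eq, List.length_append, List.length_singleton]

theorem isReduced_of_isReduced_append {ω ω' : List B} (h : cs.IsReduced (ω ++ ω')) :
    cs.IsReduced ω := by
  simpa using h.take ω.length

theorem exists_mul_wordProd_of_isRightDescent {w : W} {ω : List B} (hω : cs.IsReduced ω)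
    (hw : ∀ i ∈ ω, cs.IsRightDescent w i) :
    ∃ x : W, w = x * cs.wordProd ω ∧ cs.length w = cs.length x + ω.length := by
  induction ω using List.reverseRecOn with
  | nil => exact ⟨w, by simp, by simp⟩
  | append_singleton ω i ih =>
    have hω' := isReduced_of_isReduced_append cs hω
    obtain ⟨x, hx, hlen⟩ := ih hω' fun j hj => hw j (by simp [hj])
    obtain ⟨ξ, hξ, rfl⟩ := cs.exists_isReduced x
    rw [← cs.wordProd_append] at hx
    have hi := hw i (by simp)
    rw [hx] at hi
    obtain ⟨j, hj, hji⟩ := exists_mul_simple_eq_eraseIdx cs hi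
    rcases lt_or_ge j ξ.length with hjξ | hjξ
    · rw [List.eraseIdx_append_of_lt_length hjξ] at hji
      have hw' : w = cs.wordProd (ξ.eraseIdx j) * cs.wordProd (ω ++ [i]) := by
        rw [cs.wordProd_append, cs.wordProd_singleton, ← mul_assoc, ← cs.wordProd_append, ← hji,
          ← hx, cs.simple_mul_simple_cancel_right]
      refine ⟨_, hw', ?_⟩
      have h1 := cs.length_mul_le (cs.wordProd (ξ.eraseIdx j)) (cs.wordProd (ω ++ [i]))
      rw [← hw', hω.eq] at h1
      have h2 := cs.length_wordProd_le (ξ.eraseIdx j)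
      rw [List.length_eraseIdx_of_lt hjξ] at h2
      rw [hξ.eq] at hlen
      simp only [List.length_append, List.length_singleton] at h1 ⊢
      lia
    · exfalso
      rw [List.eraseIdx_append_of_length_le hjξ, cs.wordProd_append, cs.wordProd_append, mul_assoc,
        mul_right_inj, ← cs.wordProd_singleton, ← cs.wordProd_append] at hji
      have h1 := cs.length_wordProd_le (ω.eraseIdx (j - ξ.length))
      rw [← hji, hω.eq, List.length_append, List.length_singleton] at h1
      have := List.length_eraseIdx_le ω (j - ξ.length)
      lia

theorem exists_wordProd_mul_of_isLeftDescent {w : W} {ω : List B} (hω : cs.IsReduced ω)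
    (hw : ∀ i ∈ ω, cs.IsLeftDescent w i) :
    ∃ x : W, w = cs.wordProd ω * x ∧ cs.length w = ω.length + cs.length x := by
  obtain ⟨x, hx, hlen⟩ := exists_mul_wordProd_of_isRightDescent cs (w := w⁻¹) hω.reverse
    fun i hi => cs.isRightDescent_inv_iff.mpr (hw i (List.mem_reverse.mp hi))
  refine ⟨x⁻¹, ?_, ?_⟩
  · rw [← inv_inj, hx, cs.wordProd_reverse, mul_inv_rev, inv_inv]
  · rw [cs.length_inv, List.length_reverse] at hlen
    rw [hlen, cs.length_inv, add_comm]

/-- Matsumoto's theorem. -/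
theorem prod_map_eq_of_isReduced {G : Type*} [Monoid G] {f : B → G}
    (hf : ∀ s t, s ≠ t → M s t ≠ 0 →
      ((altList s t (M s t)).map f).prod = ((altList t s (M s t)).map f).prod)
    {ω ω' : List B} (hω : cs.IsReduced ω) (hω' : cs.IsReduced ω')
    (h : cs.wordProd ω = cs.wordProd ω') : (ω.map f).prod = (ω'.map f).prod := by
  induction hn : ω.length generalizing ω ω' with
  | zero =>
    have h' : ω'.length = 0 := by rw [← hω'.eq, ← h, hω.eq, hn]
    rw [List.length_eq_zero_iff.mp hn, List.length_eq_zero_iff.mp h']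
  | succ n ih =>
    have hn' : ω'.length = n + 1 := by rw [← hω'.eq, ← h, hω.eq, hn]
    obtain ⟨s, a, rfl⟩ := List.exists_cons_of_length_eq_add_one hn
    obtain ⟨t, b, rfl⟩ := List.exists_cons_of_length_eq_add_one hn'
    have ha : cs.IsReduced a := hω.drop 1
    have hb : cs.IsReduced b := hω'.drop 1
    simp only [List.length_cons, Nat.add_right_cancel_iff] at hn hn'
    rw [List.map_cons, List.map_cons, List.prod_cons, List.prod_cons]
    rcases eq_or_ne s t with rfl | hst
    · rw [cs.wordProd_cons, cs.wordProd_cons, mul_right_inj] at h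
      rw [ih ha hb h hn]
    have hlen : cs.length (cs.wordProd (s :: a)) = n + 1 := by rw [hω.eq, List.length_cons, hn]
    have hds : cs.IsLeftDescent (cs.wordProd (s :: a)) s := by
      rw [CoxeterSystem.IsLeftDescent, hlen, cs.wordProd_cons, cs.simple_mul_simple_cancel_left,
        ha.eq, hn]
      lia
    have hdt : cs.IsLeftDescent (cs.wordProd (s :: a)) t := by
      rw [CoxeterSystem.IsLeftDescent, hlen, h, cs.wordProd_cons,
        cs.simple_mul_simple_cancel_left, hb.eq, hn']
      lia
    have hd : ∀ k, ∀ i ∈ altList s t k, cs.IsLeftDescent (cs.wordProd (s :: a)) i := by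
      intro k i hi
      rcases mem_altList hi with rfl | rfl
      · exact hds
      · exact hdt
    rcases eq_or_ne (M s t) 0 with h0 | h0
    · obtain ⟨x, -, hl⟩ := exists_wordProd_mul_of_isLeftDescent cs
        (isReduced_altList cs hst (n := n + 2) (Or.inl h0)) (hd _)
      rw [hlen, length_altList] at hl
      lia
    obtain ⟨x, hx, hl⟩ := exists_wordProd_mul_of_isLeftDescent cs
      (isReduced_altList cs hst (Or.inr le_rfl)) (hd _)
    obtain ⟨ξ, hξ, rfl⟩ := cs.exists_isReduced x
    rw [hlen, length_altList, hξ.eq] at hl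
    obtain ⟨m, hm⟩ := Nat.exists_eq_succ_of_ne_zero h0
    have hx' := hx
    rw [wordProd_altList_comm, h] at hx'
    have hbraid := hf s t hst h0
    rw [hm, Nat.succ_eq_add_one] at hx hx' hl hbraid
    simp only [altList, cs.wordProd_cons, mul_assoc, mul_right_inj, List.map_cons,
      List.prod_cons] at hx hx' hbraid
    rw [← cs.wordProd_append] at hx hx'
    have hlen₁ : (altList t s m ++ ξ).length = n := by
      rw [List.length_append, length_altList]
      lia
    have hlen₂ : (altList s t m ++ ξ).length = n := by
      rw [List.length_append, length_altList]
      lia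
    have e₁ := ih ha (ω' := altList t s m ++ ξ)
      (by rw [CoxeterSystem.IsReduced, ← hx, ha.eq, hn, hlen₁]) hx hn
    have e₂ := ih hb (ω' := altList s t m ++ ξ)
      (by rw [CoxeterSystem.IsReduced, ← hx', hb.eq, hn', hlen₂]) hx' hn'
    rw [e₁, e₂, List.map_append, List.map_append, List.prod_append, List.prod_append,
      ← mul_assoc, ← mul_assoc, hbraid]

end Exchange

section Artin

variable (M : CoxeterMatrix B)

/-- The positive element of `Artin M` represented by a word. -/
def posWord (ω : List B) : Artin M := (ω.map (gen M)).prod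

theorem posWord_append (ω ω' : List B) : posWord M (ω ++ ω') = posWord M ω * posWord M ω' := by
  simp [posWord]

theorem posWord_cons (s : B) (ω : List B) : posWord M (s :: ω) = gen M s * posWord M ω := by
  simp [posWord]

theorem posWord_singleton (s : B) : posWord M [s] = gen M s := by
  simp [posWord]

theorem mk_prod_map_of (ω : List B) :
    (PresentedGroup.mk (braidRels M) ((ω.map FreeGroup.of).prod) : PresentedGroup (braidRels M)) =
      posWord M ω := by
  rw [map_list_prod, List.map_map]
  rfl

theorem posWord_altList_comm {s t : B} (hst : s ≠ t) (h0 : M s t ≠ 0) :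
    posWord M (altList s t (M s t)) = posWord M (altList t s (M s t)) := by
  have h := PresentedGroup.one_of_mem (rels := braidRels M) ⟨s, t, hst, h0, rfl⟩
  rw [map_mul, map_inv, mul_inv_eq_one, mk_prod_map_of, mk_prod_map_of] at h
  exact h

variable {M} in
theorem posWord_eq_of_isReduced {ω ω' : List B} (hω : M.toCoxeterSystem.IsReduced ω)
    (hω' : M.toCoxeterSystem.IsReduced ω')
    (h : M.toCoxeterSystem.wordProd ω = M.toCoxeterSystem.wordProd ω') :
    posWord M ω = posWord M ω' :=
  prod_map_eq_of_isReduced M.toCoxeterSystem (fun _ _ => posWord_altList_comm M) hω hω' h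

theorem lift_braidRels_eq_one {G : Type*} [Group G] {f : B → G}
    (hf : ∀ s t, s ≠ t → M s t ≠ 0 →
      ((altList s t (M s t)).map f).prod = ((altList t s (M s t)).map f).prod) :
    ∀ r ∈ braidRels M, FreeGroup.lift f r = 1 := by
  rintro r ⟨s, t, hst, h0, rfl⟩
  rw [map_mul, map_inv, mul_inv_eq_one, map_list_prod, map_list_prod, List.map_map, List.map_map]
  simpa [Function.comp_def] using hf s t hst h0

/-- The homomorphism from `Artin M` induced by a family satisfying the braid relations. -/
def artinLift {G : Type*} [Group G] (f : B → G)
    (hf : ∀ s t, s ≠ t → M s t ≠ 0 →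
      ((altList s t (M s t)).map f).prod = ((altList t s (M s t)).map f).prod) : Artin M →* G :=
  PresentedGroup.toGroup (lift_braidRels_eq_one M hf)

theorem artinLift_posWord {G : Type*} [Group G] (f : B → G)
    (hf : ∀ s t, s ≠ t → M s t ≠ 0 →
      ((altList s t (M s t)).map f).prod = ((altList t s (M s t)).map f).prod) (ω : List B) :
    artinLift M f hf (posWord M ω) = (ω.map f).prod := by
  rw [posWord, map_list_prod, List.map_map]
  congr 2
  funext s
  exact PresentedGroup.toGroup.of _

theorem proj_posWord (ω : List B) : proj M (posWord M ω) = M.toCoxeterSystem.wordProd ω := by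
  rw [posWord, map_list_prod, List.map_map, CoxeterSystem.wordProd]
  congr 2

theorem proj_gen (s : B) : proj M (gen M s) = M.toCoxeterSystem.simple s := by
  rw [← posWord_singleton, proj_posWord, CoxeterSystem.wordProd_singleton]

variable {M} in
theorem length_eq_of_posWord_eq {ω ω' : List B} (h : posWord M ω = posWord M ω') :
    ω.length = ω'.length := by
  have key : ∀ ω : List B, artinLift M (fun _ => Multiplicative.ofAdd (1 : ℤ))
      (by simp [length_altList]) (posWord M ω) = Multiplicative.ofAdd (ω.length : ℤ) := by
    intro ω
    rw [artinLift_posWord, List.map_const', List.prod_replicate, ← ofAdd_nsmul]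
    simp
  have h' := key ω
  rw [h, key ω'] at h'
  exact_mod_cast (Multiplicative.ofAdd.injective h').symm

/-- The action of `Artin M` on `M.Group × ℤ` through the permutations `inversionPerm`. -/
noncomputable def inversionAction : Artin M →* Equiv.Perm (M.Group × ℤ) :=
  artinLift M (inversionPerm M.toCoxeterSystem ℤ)
    (fun s t _ _ => prod_map_inversionPerm_altList M.toCoxeterSystem ℤ s t)

/-- The number of occurrences of `w` in the right inversion sequence of any positive word
representing `a`. -/
noncomputable def inversionCount (a : Artin M) (w : M.Group) : ℤ := (inversionAction M a (w, 0)).2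

open Classical in
theorem inversionAction_posWord (ω : List B) (w : M.Group) (r : ℤ) :
    inversionAction M (posWord M ω) (w, r) =
      (M.toCoxeterSystem.wordProd ω * w * (M.toCoxeterSystem.wordProd ω)⁻¹,
        r + ((M.toCoxeterSystem.rightInvSeq ω).count w : ℕ)) := by
  rw [inversionAction, artinLift_posWord, prod_map_inversionPerm_apply]

open Classical in
theorem inversionCount_posWord (ω : List B) (w : M.Group) :
    inversionCount M (posWord M ω) w = ((M.toCoxeterSystem.rightInvSeq ω).count w : ℕ) := by
  rw [inversionCount, inversionAction_posWord, zero_add]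

theorem mem_posMonOn_iff {U : Set B} {a : Artin M} :
    a ∈ posMonOn M U ↔ ∃ ω : List B, (∀ i ∈ ω, i ∈ U) ∧ posWord M ω = a := by
  constructor
  · intro h
    induction h using Submonoid.closure_induction with
    | mem x hx =>
      obtain ⟨s, hs, rfl⟩ := hx
      exact ⟨[s], by simpa using hs, posWord_singleton M s⟩
    | one => exact ⟨[], by simp, rfl⟩
    | mul x y _ _ hx hy =>
      obtain ⟨ω, hω, rfl⟩ := hx
      obtain ⟨ω', hω', rfl⟩ := hy
      refine ⟨ω ++ ω', fun i hi => ?_, posWord_append M ω ω'⟩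
      exact (List.mem_append.mp hi).elim (hω i) (hω' i)
  · rintro ⟨ω, hω, rfl⟩
    refine Submonoid.list_prod_mem _ fun x hx => ?_
    obtain ⟨s, hs, rfl⟩ := List.mem_map.mp hx
    exact Submonoid.subset_closure ⟨s, hω s hs, rfl⟩

theorem mem_posMon_iff {a : Artin M} : a ∈ posMon M ↔ ∃ ω : List B, posWord M ω = a := by
  have h := mem_posMonOn_iff M (U := Set.univ) (a := a)
  rw [posMonOn, Set.image_univ] at h
  simpa [posMon] using h

theorem mem_coxSub_iff {U : Set B} {w : M.Group} :
    w ∈ coxSub M U ↔ ∃ ω : List B, (∀ i ∈ ω, i ∈ U) ∧ M.toCoxeterSystem.wordProd ω = w := by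
  constructor
  · intro h
    induction h using Subgroup.closure_induction with
    | mem x hx =>
      obtain ⟨s, hs, rfl⟩ := hx
      exact ⟨[s], by simpa using hs, by simp⟩
    | one => exact ⟨[], by simp, rfl⟩
    | mul x y _ _ hx hy =>
      obtain ⟨ω, hω, rfl⟩ := hx
      obtain ⟨ω', hω', rfl⟩ := hy
      refine ⟨ω ++ ω', fun i hi => ?_, CoxeterSystem.wordProd_append _ ω ω'⟩
      exact (List.mem_append.mp hi).elim (hω i) (hω' i)
    | inv x _ hx =>
      obtain ⟨ω, hω, rfl⟩ := hx
      exact ⟨ω.reverse, fun i hi => hω i (List.mem_reverse.mp hi), CoxeterSystem.wordProd_reverse ..⟩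
  · rintro ⟨ω, hω, rfl⟩
    refine Subgroup.list_prod_mem _ fun x hx => ?_
    obtain ⟨s, hs, rfl⟩ := List.mem_map.mp hx
    exact Subgroup.subset_closure ⟨s, hω s hs, by simp⟩

variable {M}

theorem inversionCount_mul {a b : Artin M} (ha : a ∈ posMon M) (hb : b ∈ posMon M)
    (w : M.Group) : inversionCount M (a * b) w =
      inversionCount M b w + inversionCount M a (proj M b * w * (proj M b)⁻¹) := by
  classical
  obtain ⟨ω, rfl⟩ := (mem_posMon_iff M).mp ha
  obtain ⟨ω', rfl⟩ := (mem_posMon_iff M).mp hb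
  rw [inversionCount, map_mul, Equiv.Perm.mul_apply, inversionAction_posWord,
    inversionAction_posWord, inversionCount_posWord, inversionCount_posWord, proj_posWord, zero_add]

theorem one_le_inversionCount_of_rdvd {a : Artin M} {s : B} (h : rdvd M (gen M s) a) :
    1 ≤ inversionCount M a (M.toCoxeterSystem.simple s) := by
  classical
  obtain ⟨c, hc, rfl⟩ := h
  obtain ⟨ω, rfl⟩ := (mem_posMon_iff M).mp hc
  rw [← posWord_singleton, ← posWord_append, inversionCount_posWord, ← List.concat_eq_append,
    CoxeterSystem.rightInvSeq_concat]
  simp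

theorem rdvd_gen_of_isReduced {ω : List B} (hω : M.toCoxeterSystem.IsReduced ω) {s : B}
    (h : 1 ≤ inversionCount M (posWord M ω) (M.toCoxeterSystem.simple s)) :
    rdvd M (gen M s) (posWord M ω) := by
  classical
  rw [inversionCount_posWord] at h
  have hmem : M.toCoxeterSystem.simple s ∈ M.toCoxeterSystem.rightInvSeq ω :=
    List.one_le_count_iff.mp (by exact_mod_cast h)
  have hd := (CoxeterSystem.isRightInversion_simple_iff_isRightDescent ..).mp
    (CoxeterSystem.isRightInversion_of_mem_rightInvSeq _ hω hmem)
  obtain ⟨ξ, hξ, heq⟩ := exists_isReduced_append_singleton M.toCoxeterSystem hd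
  rw [posWord_eq_of_isReduced hω hξ heq, posWord_append, posWord_singleton]
  exact ⟨_, (mem_posMon_iff M).mpr ⟨ξ, rfl⟩, rfl⟩

theorem coxSub_mono {U V : Set B} (h : U ⊆ V) : coxSub M U ≤ coxSub M V :=
  Subgroup.closure_mono (Set.image_mono h)

/-- `Δ_U` lifts the longest element of `W_U`. -/
theorem IsDelta.exists_isReduced {U : Set B} (hU : IsSpherical M U) {d : Artin M}
    (hd : IsDelta M U d) : ∃ ω : List B, M.toCoxeterSystem.IsReduced ω ∧ (∀ i ∈ ω, i ∈ U) ∧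
      posWord M ω = d ∧ ∀ x ∈ coxSub M U, M.toCoxeterSystem.length x ≤ ω.length := by
  set cs := M.toCoxeterSystem
  have : Finite (coxSub M U) := hU
  obtain ⟨⟨w, hw⟩, hmax⟩ := Finite.exists_max fun x : coxSub M U => cs.length x.1
  obtain ⟨ω, hωU, rfl⟩ := (mem_coxSub_iff M).mp hw
  obtain ⟨ω₀, hω₀U, hω₀, heq⟩ := exists_isReduced_of_mem cs U ω hωU
  have hmax' : ∀ x ∈ coxSub M U, cs.length x ≤ ω₀.length := by
    intro x hx
    rw [← hω₀.eq, heq]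
    exact hmax ⟨x, hx⟩
  obtain ⟨hdU, hdiv, hmin⟩ := hd
  have hword : ∀ s ∈ U, ∃ c ∈ posMonOn M U, gen M s * c = posWord M ω₀ := by
    intro s hs
    obtain ⟨ξ, hξU, hξ, hξeq⟩ := exists_isReduced_of_mem cs U (s :: ω₀) (by simpa [hs] using hω₀U)
    have hle : ξ.length ≤ ω₀.length := by
      rw [← hξ.eq]
      exact hmax' _ ((mem_coxSub_iff M).mpr ⟨ξ, hξU, rfl⟩)
    have hprod : cs.wordProd (s :: ξ) = cs.wordProd ω₀ := by
      rw [cs.wordProd_cons, hξeq, cs.wordProd_cons, cs.simple_mul_simple_cancel_left]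
    have hlt : ξ.length + 1 = ω₀.length := by
      have h1 := cs.length_simple_mul (cs.wordProd ω₀) s
      rw [← cs.wordProd_cons, ← hξeq, hξ.eq, hω₀.eq] at h1
      lia
    have hred : cs.IsReduced (s :: ξ) := by
      rw [CoxeterSystem.IsReduced, hprod, hω₀.eq, List.length_cons, hlt]
    exact ⟨posWord M ξ, (mem_posMonOn_iff M).mpr ⟨ξ, hξU, rfl⟩,
      by rw [← posWord_cons, posWord_eq_of_isReduced hred hω₀ hprod]⟩
  obtain ⟨c, hc, hdc⟩ := hmin _ ((mem_posMonOn_iff M).mpr ⟨ω₀, hω₀U, rfl⟩) hword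
  obtain ⟨α, hα, rfl⟩ := (mem_posMonOn_iff M).mp hdU
  obtain ⟨β, hβ, rfl⟩ := (mem_posMonOn_iff M).mp hc
  rw [← posWord_append] at hdc
  have hlen := length_eq_of_posWord_eq hdc
  have hαβ : cs.IsReduced (α ++ β) := by
    rw [CoxeterSystem.IsReduced, hlen, ← hω₀.eq, ← proj_posWord, ← proj_posWord, hdc]
  have hαr := isReduced_of_isReduced_append cs hαβ
  have hdesc : ∀ s ∈ ω₀, cs.IsLeftDescent (cs.wordProd α) s := by
    intro s hs
    obtain ⟨c, hc, hsc⟩ := hdiv s (hω₀U s hs)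
    obtain ⟨γ, hγ, rfl⟩ := (mem_posMonOn_iff M).mp hc
    rw [← posWord_cons] at hsc
    have h1 := length_eq_of_posWord_eq hsc
    have h2 : cs.wordProd (s :: γ) = cs.wordProd α := by
      rw [← proj_posWord, ← proj_posWord, hsc]
    rw [CoxeterSystem.IsLeftDescent, hαr.eq, ← h1, ← h2, cs.wordProd_cons,
      cs.simple_mul_simple_cancel_left, List.length_cons]
    exact Nat.lt_succ_of_le (cs.length_wordProd_le γ)
  obtain ⟨x, -, hx⟩ := exists_wordProd_mul_of_isLeftDescent cs hω₀ hdesc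
  rw [hαr.eq] at hx
  exact ⟨α, hαr, hα, rfl, fun y hy => (hmax' y hy).trans (by lia)⟩

theorem IsElemRibbon.exists_isReduced {X Y : Set B} {h : Artin M} (hh : IsElemRibbon M X Y h) :
    ∃ ω : List B, M.toCoxeterSystem.IsReduced ω ∧ posWord M ω = h := by
  set cs := M.toCoxeterSystem
  obtain ⟨t, hs, ⟨-, hd⟩ | ⟨-, d₁, d₂, hd₁, hd₂, rfl⟩, -, -⟩ := hh
  · obtain ⟨ω, hω, -, h, -⟩ := hd.exists_isReduced hs
    exact ⟨ω, hω, h⟩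
  · set U := comp M (X ∪ {t}) t
    have hUfin : Finite (coxSub M U) := hs
    have hs' : IsSpherical M (U \ {t}) :=
      Finite.of_injective _ (Subgroup.inclusion_injective (coxSub_mono Set.sdiff_subset))
    obtain ⟨α, hα, hαU, rfl, hmax⟩ := hd₁.exists_isReduced hs
    obtain ⟨β, hβ, hβU, rfl, -⟩ := hd₂.exists_isReduced hs'
    have hdesc : ∀ i ∈ β, cs.IsRightDescent (cs.wordProd α) i := by
      intro i hi
      have h1 : cs.wordProd (α ++ [i]) ∈ coxSub M U := by
        refine (mem_coxSub_iff M).mpr ⟨_, fun j hj => ?_, rfl⟩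
        rcases List.mem_append.mp hj with hj | hj
        · exact hαU j hj
        · rw [List.mem_singleton.mp hj]
          exact (hβU i hi).1
      have h2 := hmax _ h1
      rw [cs.wordProd_append, cs.wordProd_singleton] at h2
      rcases cs.length_mul_simple (cs.wordProd α) i with h3 | h3
      · rw [hα.eq] at h3
        lia
      · rw [CoxeterSystem.IsRightDescent]
        lia
    obtain ⟨x, hx, hlen⟩ := exists_mul_wordProd_of_isRightDescent cs hβ hdesc
    obtain ⟨ξ, hξ, rfl⟩ := cs.exists_isReduced x
    rw [← cs.wordProd_append] at hx
    have hred : cs.IsReduced (ξ ++ β) := by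
      rw [CoxeterSystem.IsReduced, ← hx, hlen, hξ.eq, List.length_append]
    exact ⟨ξ, hξ, by
      rw [posWord_eq_of_isReduced hα hred hx, posWord_append, mul_inv_cancel_right]⟩

theorem exists_gen_mul_eq_of_leftMul_eq_rightMul {X Y : Set B} {g : Artin M}
    (h : leftMul M Y g = rightMul M X g) {s : B} (hs : s ∈ X) :
    ∃ t ∈ Y, gen M t * g = g * gen M s := by
  have hmem : g * gen M s ∈ leftMul M Y g := h ▸ ⟨s, hs, rfl⟩
  exact hmem

theorem proj_conj_simple {g : Artin M} {s t : B} (h : gen M t * g = g * gen M s) :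
    proj M g * M.toCoxeterSystem.simple s * (proj M g)⁻¹ = M.toCoxeterSystem.simple t := by
  rw [mul_inv_eq_iff_eq_mul, ← proj_gen, ← proj_gen, ← map_mul, ← map_mul, h]

theorem IsRibbon.mem_posMon {X Y : Set B} {g : Artin M} (hg : IsRibbon M X Y g) :
    g ∈ posMon M := by
  induction hg with
  | nil => exact one_mem _
  | cons _ hh ih =>
    obtain ⟨ω, -, rfl⟩ := hh.exists_isReduced
    exact mul_mem ((mem_posMon_iff M).mpr ⟨ω, rfl⟩) ih

theorem IsRibbon.exists_gen_mul_eq {X Y : Set B} {g : Artin M} (hg : IsRibbon M X Y g) {s : B}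
    (hs : s ∈ X) : ∃ t ∈ Y, gen M t * g = g * gen M s := by
  induction hg with
  | nil => exact ⟨s, hs, by simp⟩
  | cons _ hh ih =>
    obtain ⟨t, ht, h₁⟩ := ih
    obtain ⟨-, -, -, -, hYX⟩ := hh
    obtain ⟨u, hu, h₂⟩ := exists_gen_mul_eq_of_leftMul_eq_rightMul hYX ht
    exact ⟨u, hu, by rw [← mul_assoc, h₂, mul_assoc, h₁, mul_assoc]⟩

theorem IsRibbon.rdvd_gen {X Y : Set B} {g : Artin M} (hg : IsRibbon M X Y g) {s : B}
    (hs : s ∈ X) (h : 1 ≤ inversionCount M g (M.toCoxeterSystem.simple s)) :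
    rdvd M (gen M s) g := by
  induction hg with
  | nil =>
    exact rdvd_gen_of_isReduced (ω := []) (by simp [CoxeterSystem.IsReduced]) h
  | @cons Y Z g h' hg hh ih =>
    obtain ⟨ω, hω, rfl⟩ := hh.exists_isReduced
    have hpos : posWord M ω ∈ posMon M := (mem_posMon_iff M).mpr ⟨ω, rfl⟩
    obtain ⟨t, ht, hts⟩ := hg.exists_gen_mul_eq hs
    rw [inversionCount_mul hpos hg.mem_posMon, proj_conj_simple hts] at h
    rcases lt_or_ge (inversionCount M g (M.toCoxeterSystem.simple s)) 1 with h₁ | h₁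
    · obtain ⟨c, hc, hct⟩ := rdvd_gen_of_isReduced hω (s := t) (by lia)
      exact ⟨c * g, mul_mem hc hg.mem_posMon, by rw [← hct, mul_assoc, ← hts, mul_assoc]⟩
    · obtain ⟨c, hc, hcs⟩ := ih h₁
      exact ⟨posWord M ω * c, mul_mem hpos hc, by rw [mul_assoc, hcs]⟩

theorem IsRibbon.mul {X Y Z : Set B} {g h : Artin M} (hg : IsRibbon M X Y g)
    (hh : IsRibbon M Y Z h) : IsRibbon M X Z (h * g) := by
  induction hh with
  | nil => simpa using hg
  | cons _ hk ih =>
    rw [mul_assoc]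
    exact ih.cons hk

end Artin

/-- **Lemma (Godelle).** The product of a reduced-`Y` positive `Z`-ribbon-`Y` with a
reduced-`X` positive `Y`-ribbon-`X` is a reduced-`X` positive `Z`-ribbon-`X`. -/
theorem ribbon_mul_ribbon
    [Finite B] (M : CoxeterMatrix B) (X Y Z : Set B) (g h : Artin M)
    (hg : IsRibbon M X Y g) (hgr : rreduced M X g)
    (hh : IsRibbon M Y Z h) (hhr : rreduced M Y h) :
    IsRibbon M X Z (h * g) ∧ rreduced M X (h * g) := by
  refine ⟨hg.mul hh, fun s hs hdvd => ?_⟩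
  have h1 := one_le_inversionCount_of_rdvd hdvd
  obtain ⟨t, ht, hts⟩ := hg.exists_gen_mul_eq hs
  rw [inversionCount_mul hh.mem_posMon hg.mem_posMon, proj_conj_simple hts] at h1
  rcases lt_or_ge (inversionCount M g (M.toCoxeterSystem.simple s)) 1 with h2 | h2
  · exact hhr t ht (hh.rdvd_gen ht (by lia))
  · exact hgr s hs (hg.rdvd_gen hs h2)

end ArtinTitsPaper
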